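/- arXiv:2006.16038 — 8 statements merged into one kernel-verified Lean document; each statement's English description precedes it below -/
import Mathlib

section
/- (Unimodality, Theorem 1 part 1.) Let s : Fin n → ℝ be injective, let τ > 0, and let d : ℝ → ℝ → ℝ satisfy d x y ≥ 0 for all x, y and d x y = 0 ↔ x = y. Then for every row index i, the function j ↦ SoftSort^d_τ(s)[i,j] attains its maximum at the unique index j = σ_s(i); consequently the map i ↦ argmax_j SoftSort^d_τ(s)[i,j] equals the argsort permutation σ_s, and in particular is a permutation of Fin n. -/
open Real Finset

/-- **Unimodality (Theorem 1, part 1).** Let `s : Fin n → ℝ` be injective with argsort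
permutation `σ` (i.e. `s ∘ σ` strictly decreasing, so `sort(s) = s ∘ σ`), let `τ > 0`,
and let `d` be nonnegative with `d x y = 0 ↔ x = y`. Then on each row `i`, the entry
`SoftSort^d_τ(s)[i,j]` is strictly maximized at the unique column `j = σ i`; hence the
row-wise argmax of `SoftSort^d_τ(s)` is the argsort permutation `σ`. -/
theorem softsort_unimodal {n : ℕ} (s : Fin n → ℝ) (hs : Function.Injective s)
    (σ : Equiv.Perm (Fin n)) (hσ : StrictAnti (s ∘ σ))
    (d : ℝ → ℝ → ℝ) (hd_nonneg : ∀ x y, 0 ≤ d x y) (hd_eq : ∀ x y, d x y = 0 ↔ x = y)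
    (τ : ℝ) (hτ : 0 < τ) :
    ∀ i j : Fin n, j ≠ σ i →
      Real.exp (-d (s (σ i)) (s j) / τ) / (∑ k, Real.exp (-d (s (σ i)) (s k) / τ))
        < Real.exp (-d (s (σ i)) (s (σ i)) / τ) /
            (∑ k, Real.exp (-d (s (σ i)) (s k) / τ)) := by
  intro i j hj
  have hpos : 0 < d (s (σ i)) (s j) :=
    lt_of_le_of_ne (hd_nonneg _ _) fun h => hj (hs ((hd_eq _ _).1 h.symm)).symm
  have hzero : d (s (σ i)) (s (σ i)) = 0 := (hd_eq _ _).2 rfl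
  have hsum : 0 < ∑ k, Real.exp (-d (s (σ i)) (s k) / τ) :=
    Finset.sum_pos (fun k _ => Real.exp_pos _) ⟨i, Finset.mem_univ i⟩
  apply div_lt_div_of_pos_right _ hsum
  apply Real.exp_lt_exp.2
  apply div_lt_div_of_pos_right _ hτ
  linarith
end

section
/- (Limiting behavior, Theorem 1 part 2.) Let s : Fin n → ℝ be injective and let d : ℝ → ℝ → ℝ satisfy d x y ≥ 0 for all x, y and d x y = 0 ↔ x = y. Then for all indices i, j, the entry SoftSort^d_τ(s)[i,j] tends, as τ → 0 from the right, to P_s[i,j], where P_s is the permutation matrix of the argsort permutation; i.e., lim_{τ→0⁺} SoftSort^d_τ(s)[i,j] = 1 if j = σ_s(i) and 0 otherwise. -/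
open Real Finset Filter

/-- **Limiting behavior (Theorem 1, part 2).** Let `s : Fin n → ℝ` be injective with
argsort permutation `σ` (i.e. `s ∘ σ` strictly decreasing, so `sort(s) = s ∘ σ`), and
let `d` be nonnegative with `d x y = 0 ↔ x = y`. Then as `τ → 0⁺`, each entry
`SoftSort^d_τ(s)[i,j]` converges to the permutation-matrix entry `P_s[i,j]`, which is
`1` if `j = σ i` and `0` otherwise. -/
theorem softsort_limit {n : ℕ} (s : Fin n → ℝ) (hs : Function.Injective s)
    (σ : Equiv.Perm (Fin n)) (hσ : StrictAnti (s ∘ σ))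
    (d : ℝ → ℝ → ℝ) (hd_nonneg : ∀ x y, 0 ≤ d x y) (hd_eq : ∀ x y, d x y = 0 ↔ x = y) :
    ∀ i j : Fin n,
      Tendsto
        (fun τ : ℝ =>
          Real.exp (-d (s (σ i)) (s j) / τ) / ∑ k, Real.exp (-d (s (σ i)) (s k) / τ))
        (nhdsWithin 0 (Set.Ioi 0))
        (nhds (if j = σ i then (1 : ℝ) else 0)) := by
  intro i j
  have key : ∀ k : Fin n, Tendsto (fun τ : ℝ => Real.exp (-d (s (σ i)) (s k) / τ))
      (nhdsWithin 0 (Set.Ioi 0)) (nhds (if k = σ i then (1 : ℝ) else 0)) := by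
    intro k
    by_cases h : k = σ i
    · simp [h, (hd_eq (s (σ i)) (s (σ i))).2 rfl]
    · have hpos : 0 < d (s (σ i)) (s k) :=
        lt_of_le_of_ne (hd_nonneg _ _) fun h0 => h (hs ((hd_eq _ _).1 h0.symm)).symm
      rw [if_neg h]
      have hb : Tendsto (fun τ : ℝ => -d (s (σ i)) (s k) / τ)
          (nhdsWithin 0 (Set.Ioi 0)) atBot := by
        simp only [div_eq_mul_inv]
        exact tendsto_inv_nhdsGT_zero.const_mul_atTop_of_neg (neg_lt_zero.2 hpos)
      exact Real.tendsto_exp_atBot.comp hb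
  have hsum := tendsto_finsetSum (Finset.univ : Finset (Fin n)) fun k _ => key k
  have h1 : (∑ k : Fin n, if k = σ i then (1 : ℝ) else 0) = 1 := by simp
  rw [h1] at hsum
  have h2 := (key j).div hsum one_ne_zero
  rw [div_one] at h2
  exact h2
end

section
/- (Proposition 2 for NeuralSort.) Let s : Fin n → ℝ be injective and τ > 0. Then NeuralSort_τ(s) = NeuralSort_τ(sort(s)) · P_s, where the product is matrix multiplication and P_s is the permutation matrix of the argsort permutation of s. -/
open Real Finset

/-- **Proposition 2 for NeuralSort.** Let `s : Fin n → ℝ` be injective with argsort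
permutation `σ` (i.e. `s ∘ σ` strictly decreasing, so `sort(s) = s ∘ σ`), and `τ > 0`.
With rows/columns indexed by `i j : Fin n` (representing indices `i+1, j+1 ∈ {1,…,n}`),
the NeuralSort logits are `c s i j = (n + 1 − 2(i+1))·s j − ∑ₖ |s j − s k|` and
`NeuralSort_τ(s)[i,j] = exp(c s i j / τ) / ∑ₖ exp(c s i k / τ)`. Then
`NeuralSort_τ(s) = NeuralSort_τ(sort(s)) · P_s` where `P_s[i,j] = 1` iff `j = σ i`. -/
theorem neuralsort_perm_equivariance {n : ℕ} (s : Fin n → ℝ) (hs : Function.Injective s)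
    (σ : Equiv.Perm (Fin n)) (hσ : StrictAnti (s ∘ σ))
    (τ : ℝ) (hτ : 0 < τ)
    (c : (Fin n → ℝ) → Fin n → Fin n → ℝ)
    (hc : ∀ (t : Fin n → ℝ) (i j : Fin n),
      c t i j = ((n : ℝ) + 1 - 2 * ((i : ℕ) + 1)) * t j - ∑ k, |t j - t k|) :
    (Matrix.of fun i j : Fin n =>
        Real.exp (c s i j / τ) / ∑ k, Real.exp (c s i k / τ))
      =
    (Matrix.of fun i j : Fin n =>
        Real.exp (c (s ∘ σ) i j / τ) / ∑ k, Real.exp (c (s ∘ σ) i k / τ))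
      * (Matrix.of fun i j : Fin n => if j = σ i then (1 : ℝ) else 0) := by
  have key : ∀ i j, c (s ∘ σ) i j = c s i (σ j) := by
    intro i j
    rw [hc, hc]
    simp only [Function.comp_apply]
    rw [Equiv.sum_comp σ (fun k => |s (σ j) - s k|)]
  ext i j
  obtain ⟨m, rfl⟩ := σ.surjective j
  simp only [Matrix.mul_apply, Matrix.of_apply, key, σ.injective.eq_iff]
  rw [Equiv.sum_comp σ (fun k => Real.exp (c s i k / τ))]
  simp
end

section
/- (Proposition: NeuralSort rows are Gaussian densities under equal spacing.) Let a > 0 and b ∈ ℝ, let n ≥ 1, and define s_k = b − a·k for k = 1, …, n. Then for every τ > 0 and every i ∈ {1,…,n} there exists a constant c_i > 0 such that for every j ∈ {1,…,n}, NeuralSort_τ(s)[i,j] = c_i · exp(-(s_i − s_j)² / (a·τ)); that is, the i-th row of NeuralSort_τ(s) is proportional (in j) to exp(-(s_i − s_j)²/(a·τ)). -/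
open Real Finset

lemma abs_sum_low (j m : ℕ) (h : m ≤ j) :
    ∑ k ∈ range m, |(j : ℝ) - k| = m * j - m * (m - 1) / 2 := by
  induction m with
  | zero => simp
  | succ m ih =>
    have h1 : (m : ℝ) ≤ j := by exact_mod_cast (by omega : m ≤ j)
    rw [sum_range_succ, ih (by omega), abs_of_nonneg (by linarith)]
    push_cast
    ring

lemma abs_sum_all (j d : ℕ) :
    ∑ k ∈ range (j + d), |(j : ℝ) - k| = (j * (j + 1) + d * (d - 1)) / 2 := by
  induction d with
  | zero =>
    rw [add_zero, abs_sum_low j j le_rfl]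
    push_cast
    ring
  | succ d ih =>
    have h1 : (0 : ℝ) ≤ d := Nat.cast_nonneg d
    rw [← add_assoc, sum_range_succ, ih, abs_of_nonpos (by push_cast; linarith)]
    push_cast
    ring

/-- **NeuralSort rows are Gaussian densities under equal spacing (Proposition 5).**
Let `a > 0`, `b ∈ ℝ`, `n ≥ 1`, and `s_k = b − a·k` for `k ∈ {1,…,n}` (here `k : Fin n`
represents the index `k+1`). With NeuralSort logits
`c i j = (n + 1 − 2(i+1))·s j − ∑ₖ |s j − s k|` and entries
`NeuralSort_τ(s)[i,j] = exp(c i j/τ)/∑ₖ exp(c i k/τ)`, for every `τ > 0` and row `i`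
there is a constant `cᵢ > 0` with
`NeuralSort_τ(s)[i,j] = cᵢ · exp(-(s i − s j)²/(a·τ))` for every `j`. -/
theorem neuralsort_rows_gaussian {n : ℕ} (hn : 1 ≤ n) (a b : ℝ) (ha : 0 < a)
    (s : Fin n → ℝ) (hs : ∀ k : Fin n, s k = b - a * ((k : ℕ) + 1))
    (c : Fin n → Fin n → ℝ)
    (hc : ∀ i j : Fin n,
      c i j = ((n : ℝ) + 1 - 2 * ((i : ℕ) + 1)) * s j - ∑ k, |s j - s k|)
    (τ : ℝ) (hτ : 0 < τ) :
    ∀ i : Fin n, ∃ ci : ℝ, 0 < ci ∧ ∀ j : Fin n,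
      Real.exp (c i j / τ) / (∑ k, Real.exp (c i k / τ))
        = ci * Real.exp (-(s i - s j) ^ 2 / (a * τ)) := by
  intro i
  have key : ∀ j : Fin n, c i j / τ =
      (((n : ℝ) + 1 - 2 * ((i : ℕ) + 1)) * b + a * ((i : ℕ) + 1) ^ 2 - a * n * (n + 1) / 2) / τ
        + -(s i - s j) ^ 2 / (a * τ) := by
    intro j
    have hsum : ∑ k, |s j - s k| = a * ∑ k ∈ range n, |((j : ℕ) : ℝ) - k| := by
      rw [← Fin.sum_univ_eq_sum_range (fun k : ℕ => |((j : ℕ) : ℝ) - k|) n, mul_sum]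
      refine sum_congr rfl fun k _ => ?_
      rw [hs, hs, show b - a * (((j : ℕ) : ℝ) + 1) - (b - a * (((k : ℕ) : ℝ) + 1))
        = -(a * (((j : ℕ) : ℝ) - (k : ℕ))) by ring, abs_neg, abs_mul, abs_of_pos ha]
    obtain ⟨d, hd⟩ := Nat.exists_eq_add_of_le j.isLt.le
    have h2 : ∑ k ∈ range n, |((j : ℕ) : ℝ) - k|
        = ((j : ℕ) * ((j : ℕ) + 1) + d * (d - 1)) / 2 := by
      have := abs_sum_all j d
      rwa [← hd] at this
    have hn' : (n : ℝ) = (j : ℕ) + d := by exact_mod_cast hd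
    rw [hc, hsum, h2, hs i, hs j, hn']
    field_simp
    ring
  set K := (((n : ℝ) + 1 - 2 * ((i : ℕ) + 1)) * b + a * ((i : ℕ) + 1) ^ 2
    - a * n * (n + 1) / 2) / τ
  have hpos : 0 < ∑ k, Real.exp (c i k / τ) :=
    sum_pos (fun k _ => Real.exp_pos _) ⟨i, mem_univ i⟩
  refine ⟨Real.exp K / ∑ k, Real.exp (c i k / τ), div_pos (Real.exp_pos _) hpos, fun j => ?_⟩
  rw [div_mul_eq_mul_div, ← Real.exp_add, ← key j]
end

section
/- (Algebraic identity underlying the equal-spacing Gaussian proposition.) Let n ≥ 1, let i, j ∈ {1,…,n}, let a > 0 and b ∈ ℝ, and set s_k = b − a·k for k = 1,…,n. Then (n + 1 − 2i)·s_j − ∑_{k=1}^n |s_k − s_j| = -(s_i − s_j)²/a + a·(i² − n²/2 − n/2) − b·(2i − n − 1). In particular, the second summand on the right-hand side does not depend on j. -/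
open Finset

lemma sum_abs_low (j m : ℕ) (h : m ≤ j) :
    ∑ k ∈ Finset.Icc 1 m, |(k : ℝ) - j| = m * j - m * (m + 1) / 2 := by
  induction m with
  | zero => simp
  | succ m ih =>
    rw [Finset.sum_Icc_succ_top (by omega), ih (by omega)]
    have h' : ((m + 1 : ℕ) : ℝ) ≤ j := by exact_mod_cast h
    rw [abs_of_nonpos (by linarith)]
    push_cast
    ring

lemma sum_abs_all (j n : ℕ) (h : j ≤ n) :
    ∑ k ∈ Finset.Icc 1 n, |(k : ℝ) - j|
      = (j : ℝ) ^ 2 - j + (n : ℝ) ^ 2 / 2 - n * j + n / 2 := by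
  induction n, h using Nat.le_induction with
  | base => rw [sum_abs_low j j le_rfl]; ring
  | succ m hm ih =>
    rw [Finset.sum_Icc_succ_top (by omega), ih]
    have h' : (j : ℝ) ≤ m := by exact_mod_cast hm
    rw [abs_of_nonneg (by push_cast; linarith)]
    push_cast
    ring

/-- **Algebraic identity underlying the equal-spacing Gaussian proposition.** Let
`n ≥ 1`, `i, j ∈ {1,…,n}`, `a > 0`, `b ∈ ℝ`, and `s_k = b − a·k`. Then
`(n + 1 − 2i)·s_j − ∑_{k=1}^n |s_k − s_j|
  = −(s_i − s_j)²/a + a·(i² − n²/2 − n/2) − b·(2i − n − 1)`. -/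
theorem neuralsort_logit_identity (n : ℕ) (hn : 1 ≤ n) (i j : ℕ)
    (hi : i ∈ Finset.Icc 1 n) (hj : j ∈ Finset.Icc 1 n)
    (a b : ℝ) (ha : 0 < a) (s : ℕ → ℝ) (hs : ∀ k, s k = b - a * k) :
    ((n : ℝ) + 1 - 2 * i) * s j - ∑ k ∈ Finset.Icc 1 n, |s k - s j|
      = -(s i - s j) ^ 2 / a + a * ((i : ℝ) ^ 2 - (n : ℝ) ^ 2 / 2 - (n : ℝ) / 2)
        - b * (2 * (i : ℝ) - (n : ℝ) - 1) := by
  have hsum : ∑ k ∈ Finset.Icc 1 n, |s k - s j|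
      = a * ∑ k ∈ Finset.Icc 1 n, |(k : ℝ) - j| := by
    rw [Finset.mul_sum]
    refine Finset.sum_congr rfl fun k _ => ?_
    rw [hs, hs, show b - a * (k : ℝ) - (b - a * j) = -(a * ((k : ℝ) - j)) by ring,
      abs_neg, abs_mul, abs_of_pos ha]
  rw [hsum, sum_abs_all j n (Finset.mem_Icc.mp hj).2, hs i, hs j]
  field_simp
  ring
end

section
/- (SoftSort with squared distance recovers NeuralSort on equally spaced inputs.) Let a > 0, b ∈ ℝ, n ≥ 1, τ > 0, and define s_k = b − a·k for k = 1,…,n. Then SoftSort^{|·|²}_{aτ}(s) = NeuralSort_τ(s) as n × n matrices, i.e., for all i, j ∈ {1,…,n}: exp(-(s_i − s_j)²/(aτ)) / ∑_k exp(-(s_i − s_k)²/(aτ)) = exp(c_i(j)/τ) / ∑_k exp(c_i(k)/τ), where c_i(j) = (n + 1 − 2i)·s_j − ∑_{k=1}^n |s_j − s_k|. -/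
open Real Finset

lemma sum_abs_aux1 (j m : ℕ) (h : m ≤ j) :
    ∑ k ∈ Finset.range m, |(j : ℝ) - k| = m * j - m * (m - 1) / 2 := by
  induction m with
  | zero => simp
  | succ m ih =>
    have h1 : (m : ℝ) + 1 ≤ j := by exact_mod_cast h
    rw [Finset.sum_range_succ, ih (by omega), abs_of_nonneg (by linarith)]
    push_cast
    ring

lemma sum_abs_aux2 (j n : ℕ) (h : j ≤ n) :
    ∑ k ∈ Finset.range n, |(j : ℝ) - k| = j ^ 2 + j - n * j + (n ^ 2 - n) / 2 := by
  induction n, h using Nat.le_induction with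
  | base => rw [sum_abs_aux1 j j le_rfl]; ring
  | succ n hn ih =>
    have h1 : (j : ℝ) ≤ n := by exact_mod_cast hn
    rw [Finset.sum_range_succ, ih, abs_of_nonpos (by linarith)]
    push_cast
    ring

/-- **SoftSort with squared distance recovers NeuralSort on equally spaced inputs.**
Let `a > 0`, `b ∈ ℝ`, `n ≥ 1`, `τ > 0`, and `s_k = b − a·k` for `k ∈ {1,…,n}` (here
`k : Fin n` represents the index `k+1`; `s` is strictly decreasing, so `sort(s) = s`).
With NeuralSort logits `c i j = (n + 1 − 2(i+1))·s j − ∑ₖ |s j − s k|`, we have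
`SoftSort^{|·|²}_{aτ}(s) = NeuralSort_τ(s)` entrywise:
`exp(-(s i − s j)²/(aτ)) / ∑ₖ exp(-(s i − s k)²/(aτ)) = exp(c i j/τ)/∑ₖ exp(c i k/τ)`. -/
theorem softsort_sq_eq_neuralsort_equal_spacing {n : ℕ} (hn : 1 ≤ n)
    (a b : ℝ) (ha : 0 < a) (τ : ℝ) (hτ : 0 < τ)
    (s : Fin n → ℝ) (hs : ∀ k : Fin n, s k = b - a * ((k : ℕ) + 1))
    (c : Fin n → Fin n → ℝ)
    (hc : ∀ i j : Fin n,
      c i j = ((n : ℝ) + 1 - 2 * ((i : ℕ) + 1)) * s j - ∑ k, |s j - s k|) :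
    ∀ i j : Fin n,
      Real.exp (-(s i - s j) ^ 2 / (a * τ)) /
          (∑ k, Real.exp (-(s i - s k) ^ 2 / (a * τ)))
        = Real.exp (c i j / τ) / ∑ k, Real.exp (c i k / τ) := by
  intro i
  have key : ∀ j : Fin n, c i j / τ = -(s i - s j) ^ 2 / (a * τ) +
      (((n : ℝ) - 1 - 2 * (i : ℕ)) * (b - a) + a * (i : ℕ) ^ 2 - a * ((n : ℝ) ^ 2 - n) / 2) / τ := by
    intro j
    have hsum : ∑ k, |s j - s k| =
        a * (((j : ℕ) : ℝ) ^ 2 + (j : ℕ) - n * (j : ℕ) + ((n : ℝ) ^ 2 - n) / 2) := by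
      rw [← sum_abs_aux2 j n j.2.le, Finset.mul_sum,
        ← Fin.sum_univ_eq_sum_range (fun k => a * |((j : ℕ) : ℝ) - (k : ℝ)|) n]
      refine Finset.sum_congr rfl fun k _ => ?_
      rw [hs j, hs k, ← abs_of_pos ha, ← abs_mul, abs_of_pos ha, abs_sub_comm ]
      congr 1
      ring
    rw [hc, hsum, hs i, hs j]
    field_simp
    ring
  intro j
  simp only [key, Real.exp_add, ← Finset.sum_mul]
  rw [mul_div_mul_right _ _ (Real.exp_ne_zero _)]
end

section
/- (First row of SoftSort is the softmax of the input.) Let s : Fin n → ℝ be injective and τ > 0, and let i₀ be the first row index (the row corresponding to the largest sorted value, so sort(s) i₀ = max_k s_k). Then for every j, SoftSort^{|·|}_τ(s)[i₀, j] = exp(s_j/τ) / ∑_k exp(s_k/τ); i.e., the first row of SoftSort^{|·|}_τ(s) is precisely the softmax of s with temperature τ. -/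
open Real Finset

/-- **The first row of SoftSort is the softmax of the input.** Let `s : Fin n → ℝ` be
injective with argsort permutation `σ` (i.e. `s ∘ σ` strictly decreasing, so
`sort(s) = s ∘ σ`), `τ > 0`, and let `i₀ = ⟨0, hn⟩` be the first row index (so
`sort(s) i₀ = max_k s k`). Then for every `j`,
`SoftSort^{|·|}_τ(s)[i₀, j] = exp(s j/τ) / ∑ₖ exp(s k/τ)`. -/
theorem softsort_first_row_softmax {n : ℕ} (hn : 0 < n)
    (s : Fin n → ℝ) (hs : Function.Injective s)
    (σ : Equiv.Perm (Fin n)) (hσ : StrictAnti (s ∘ σ)) (τ : ℝ) (hτ : 0 < τ) :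
    ∀ j : Fin n,
      Real.exp (-|s (σ ⟨0, hn⟩) - s j| / τ) /
          (∑ k, Real.exp (-|s (σ ⟨0, hn⟩) - s k| / τ))
        = Real.exp (s j / τ) / ∑ k, Real.exp (s k / τ) := by
  intro j
  have hmax : ∀ k, s k ≤ s (σ ⟨0, hn⟩) := by
    intro k
    have h := hσ.antitone (show (⟨0, hn⟩ : Fin n) ≤ σ.symm k from Nat.zero_le _)
    simpa using h
  have key : ∀ k, Real.exp (-|s (σ ⟨0, hn⟩) - s k| / τ)
      = Real.exp (-s (σ ⟨0, hn⟩) / τ) * Real.exp (s k / τ) := by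
    intro k
    rw [abs_of_nonneg (sub_nonneg.mpr (hmax k)), ← Real.exp_add]
    congr 1
    ring
  simp only [key]
  rw [← Finset.mul_sum, mul_div_mul_left _ _ (Real.exp_ne_zero _)]
end

section
/- (Softmax converges to the one-hot argmax vector as the temperature tends to zero.) Let v : Fin n → ℝ and suppose there is an index j* with v j* > v j for all j ≠ j*. Then for every j, the quantity exp(v j / τ) / ∑_k exp(v k / τ) tends, as τ → 0 from the right, to 1 if j = j* and to 0 otherwise. -/
open Real Finset Filter

/-- **Softmax converges to the one-hot argmax vector as the temperature tends to
zero.** Let `v : Fin n → ℝ` have a unique maximizer `j*` (i.e. `v j* > v j` for all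
`j ≠ j*`). Then for every `j`, `exp(v j/τ) / ∑ₖ exp(v k/τ)` tends, as `τ → 0⁺`, to `1`
if `j = j*` and to `0` otherwise. -/
theorem softmax_tendsto_one_hot {n : ℕ} (v : Fin n → ℝ) (jstar : Fin n)
    (hmax : ∀ j : Fin n, j ≠ jstar → v j < v jstar) :
    ∀ j : Fin n,
      Tendsto (fun τ : ℝ => Real.exp (v j / τ) / ∑ k, Real.exp (v k / τ))
        (nhdsWithin 0 (Set.Ioi 0))
        (nhds (if j = jstar then (1 : ℝ) else 0)) := by
  have key : ∀ k : Fin n, Tendsto (fun τ : ℝ => Real.exp ((v k - v jstar) / τ))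
      (nhdsWithin 0 (Set.Ioi 0)) (nhds (if k = jstar then (1 : ℝ) else 0)) := by
    intro k
    by_cases hk : k = jstar
    · subst hk
      simp
    · rw [if_neg hk]
      have hneg : v k - v jstar < 0 := sub_neg.mpr (hmax k hk)
      have h : Tendsto (fun τ : ℝ => (v k - v jstar) * τ⁻¹)
          (nhdsWithin 0 (Set.Ioi 0)) atBot :=
        Tendsto.const_mul_atTop_of_neg hneg tendsto_inv_nhdsGT_zero
      simpa only [div_eq_mul_inv, Function.comp_def] using Real.tendsto_exp_atBot.comp h
  intro j
  have hsum := tendsto_finsetSum (Finset.univ : Finset (Fin n)) (fun k _ => key k)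
  have hone : (∑ k : Fin n, if k = jstar then (1 : ℝ) else 0) = 1 := by simp
  rw [hone] at hsum
  have hdiv := (key j).div hsum one_ne_zero
  rw [div_one] at hdiv
  refine hdiv.congr fun τ => ?_
  simp only [Pi.div_apply, sub_div, Real.exp_sub]
  rw [← Finset.sum_div, div_div_div_cancel_right₀ (Real.exp_ne_zero _)]
end
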